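/- Consider a finite set of events with HLC timestamps computed by the HLC update rules along process-order and message edges, and let happens-before be the transitive closure of these edges. If two events e and f have equal HLC timestamps, then e and f are causally concurrent: neither e happens-before f nor f happens-before e. -/

import Mathlib

/-- The HLC send/local-event update on a current timestamp `cur` with physical clock
value `pt`: the new `l` is `max(cur.l, pt)`, and `c = cur.c + 1` if `l = cur.l`,
`c = 0` otherwise. -/
def hlcSend (cur : ℕ × ℕ) (pt : ℕ) : ℕ × ℕ :=
  let l := max cur.1 pt
  if l = cur.1 then (l, cur.2 + 1) else (l, 0)

/-- The HLC receive-update on a current timestamp `cur` with physical clock value `pt`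
and message timestamp `m`: the new `l` is `max(cur.l, m.l, pt)`, with the counter
defined by cases as in the HLC algorithm. -/
def hlcRecv (cur : ℕ × ℕ) (pt : ℕ) (m : ℕ × ℕ) : ℕ × ℕ :=
  let l := max cur.1 (max m.1 pt)
  if l = cur.1 ∧ l = m.1 then (l, max cur.2 m.2 + 1)
  else if l = cur.1 then (l, cur.2 + 1)
  else if l = m.1 then (l, m.2 + 1)
  else (l, 0)

def hlcLt (a b : ℕ × ℕ) : Prop := a.1 < b.1 ∨ (a.1 = b.1 ∧ a.2 < b.2)

theorem hlcLt_send (a : ℕ × ℕ) (pt : ℕ) : hlcLt a (hlcSend a pt) := by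
  unfold hlcLt hlcSend
  dsimp only
  split_ifs <;> dsimp only <;> omega

theorem hlcLt_recv_cur (a : ℕ × ℕ) (pt : ℕ) (m : ℕ × ℕ) : hlcLt a (hlcRecv a pt m) := by
  unfold hlcLt hlcRecv
  dsimp only
  split_ifs <;> dsimp only <;> omega

theorem hlcLt_recv_msg (a : ℕ × ℕ) (pt : ℕ) (m : ℕ × ℕ) : hlcLt m (hlcRecv a pt m) := by
  unfold hlcLt hlcRecv
  dsimp only
  split_ifs <;> dsimp only <;> omega

/-- Consider a finite set `E` of events with HLC timestamps computed by the HLC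
update rules along process-order edges `proc` and message edges `msg` (receives use
the sender's timestamp as message timestamp), and let happens-before be the
transitive closure of the edges.  If two events `e` and `f` have equal HLC
timestamps then they are causally concurrent: neither happens-before the other. -/
theorem hlc_eq_concurrent {E : Type} [Fintype E]
    (proc msg : E → E → Prop) (hlc : E → ℕ × ℕ)
    (hproc : ∀ e f, proc e f →
      (∃ pt, hlc f = hlcSend (hlc e) pt) ∨
      (∃ pt m, hlc f = hlcRecv (hlc e) pt m))
    (hmsg : ∀ e f, msg e f → ∃ cur pt, hlc f = hlcRecv cur pt (hlc e))
    (e f : E) (heq : hlc e = hlc f) :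
    ¬ Relation.TransGen (fun a b => proc a b ∨ msg a b) e f ∧
    ¬ Relation.TransGen (fun a b => proc a b ∨ msg a b) f e := by
  have step : ∀ a b, (proc a b ∨ msg a b) → hlcLt (hlc a) (hlc b) := by
    rintro a b (h | h)
    · rcases hproc a b h with ⟨pt, h⟩ | ⟨pt, m, h⟩
      · rw [h]; exact hlcLt_send _ _
      · rw [h]; exact hlcLt_recv_cur _ _ _
    · obtain ⟨cur, pt, h⟩ := hmsg a b h
      rw [h]; exact hlcLt_recv_msg _ _ _
  have key : ∀ a b, Relation.TransGen (fun a b => proc a b ∨ msg a b) a b →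
      hlcLt (hlc a) (hlc b) := by
    intro a b h
    induction h with
    | single h => exact step _ _ h
    | tail _ h ih =>
      have := step _ _ h
      unfold hlcLt at *
      omega
  constructor
  · intro h
    have := key _ _ h
    rw [heq] at this
    unfold hlcLt at this
    omega
  · intro h
    have := key _ _ h
    rw [heq] at this
    unfold hlcLt at this
    omega
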